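/- arXiv:2311.14491 — 2 statements merged into one kernel-verified Lean document; each statement's English description precedes it below -/
import Mathlib

section
/- With f₀ and h as in the context: if x = (w,y) satisfies w ≥ w₂ and |f₀(x)| = 2h, then the full gradient of f₀ at x (in all four variables (w,y)) is nonzero. -/
open Real MeasureTheory

noncomputable section

/-- `w_k = (27/8)·k^{3/2}`. -/
def wseq (k : ℕ) : ℝ := (27 / 8) * (k : ℝ) ^ ((3 : ℝ) / 2)

/-- The properties of the fixed cutoff function `ζ`: smooth, `ζ = 0` on `(-∞,0]`,
`ζ = 1` on `[1,∞)`, `0 ≤ ζ ≤ 1`, `ζ' > 0` on `(0,1)`, and `ζ(t) + ζ(1-t) = 1`. -/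
def IsCutoff (ζ : ℝ → ℝ) : Prop :=
  ContDiff ℝ (⊤ : ℕ∞) ζ ∧ (∀ t : ℝ, t ≤ 0 → ζ t = 0) ∧ (∀ t : ℝ, 1 ≤ t → ζ t = 1) ∧
    (∀ t : ℝ, ζ t ∈ Set.Icc (0 : ℝ) 1) ∧ (∀ t ∈ Set.Ioo (0 : ℝ) 1, 0 < deriv ζ t) ∧
    (∀ t : ℝ, ζ t + ζ (1 - t) = 1)

/-- The properties of the fixed sequence `(a_k)` in `ℤ³`:
`|a_k|² = 4k+1` and `|a_k · a_{k+1}| ≤ |a_k||a_{k+1}|/√3` for all `k ≥ 1`. -/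
def IsGoodSeq (a : ℕ → Fin 3 → ℤ) : Prop :=
  ∀ k : ℕ, 1 ≤ k →
    ((∑ i : Fin 3, (a k i) ^ 2 = 4 * (k : ℤ) + 1) ∧
      |∑ i : Fin 3, ((a k i : ℝ) * (a (k + 1) i : ℝ))| ≤
        Real.sqrt (∑ i : Fin 3, (a k i : ℝ) ^ 2) *
          Real.sqrt (∑ i : Fin 3, (a (k + 1) i : ℝ) ^ 2) / Real.sqrt 3)

/-- The function `f₀(w,y) = Σ_{k≥2} ζ((w-w_{k-1})/(w_k-w_{k-1}))·ζ((w_{k+1}-w)/(w_{k+1}-w_k))·cos(a_k·y)`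
(a locally finite sum), `2π`-periodic in each coordinate of `y`. -/
def f0 (ζ : ℝ → ℝ) (a : ℕ → Fin 3 → ℤ) (w : ℝ) (y : Fin 3 → ℝ) : ℝ :=
  ∑' k : ℕ, if 2 ≤ k then
      ζ ((w - wseq (k - 1)) / (wseq k - wseq (k - 1))) *
        ζ ((wseq (k + 1) - w) / (wseq (k + 1) - wseq k)) *
        Real.cos (∑ i : Fin 3, (a k i : ℝ) * y i)
    else 0

/-- `h = (2e)^{-10}`. -/
def hSmall : ℝ := 1 / (2 * Real.exp 1) ^ 10

/-- `Ω = {(w,y) : w ≥ w₂, |f₀(w,y)| < 2h}`, viewed as the (2π-periodic in `y`)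
subset of `ℝ × ℝ³` corresponding to a subset of `ℝ × T³`. -/
def OmegaSet (ζ : ℝ → ℝ) (a : ℕ → Fin 3 → ℤ) : Set (ℝ × (Fin 3 → ℝ)) :=
  {p | wseq 2 ≤ p.1 ∧ |f0 ζ a p.1 p.2| < 2 * hSmall}

end

noncomputable section
open Real

theorem wseq_strictMono : StrictMono wseq := by
  intro m n hmn
  have h : (m : ℝ) < n := by exact_mod_cast hmn
  have := Real.rpow_lt_rpow (Nat.cast_nonneg m) h (by norm_num : (0 : ℝ) < 3 / 2)
  unfold wseq
  linarith

theorem tendsto_wseq_atTop : Filter.Tendsto wseq Filter.atTop Filter.atTop :=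
  ((tendsto_rpow_atTop (by norm_num : (0 : ℝ) < 3 / 2)).comp
    tendsto_natCast_atTop_atTop).const_mul_atTop (by norm_num)

theorem exists_wseq_le_lt {w : ℝ} (hw : wseq 2 ≤ w) :
    ∃ k, 2 ≤ k ∧ wseq k ≤ w ∧ w < wseq (k + 1) := by
  classical
  have hex : ∃ n, w < wseq n := (tendsto_wseq_atTop.eventually_gt_atTop w).exists
  have hfind := Nat.find_spec hex
  have hgt : 2 < Nat.find hex := wseq_strictMono.lt_iff_lt.1 (hw.trans_lt hfind)
  obtain ⟨k, hk⟩ : ∃ k, Nat.find hex = k + 1 := ⟨Nat.find hex - 1, by omega⟩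
  refine ⟨k, by omega, not_lt.1 (Nat.find_min hex (by omega)), hk ▸ hfind⟩

/-- Between consecutive nodes, `f0` interpolates between two plane waves. -/
theorem f0_eq_of_mem_Icc {ζ : ℝ → ℝ} (hζ : IsCutoff ζ) (a : ℕ → Fin 3 → ℤ) {k : ℕ} (hk : 2 ≤ k)
    {w : ℝ} (h₁ : wseq k ≤ w) (h₂ : w ≤ wseq (k + 1)) (y : Fin 3 → ℝ) :
    f0 ζ a w y =
      (1 - ζ ((w - wseq k) / (wseq (k + 1) - wseq k))) * Real.cos (∑ i, (a k i : ℝ) * y i) +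
        ζ ((w - wseq k) / (wseq (k + 1) - wseq k)) *
          Real.cos (∑ i, (a (k + 1) i : ℝ) * y i) := by
  obtain ⟨-, hzero, hone, -, -, hsymm⟩ := hζ
  have hpos {m n : ℕ} (h : m < n) : 0 < wseq n - wseq m := sub_pos.2 (wseq_strictMono h)
  unfold f0
  rw [tsum_eq_sum (s := {k, k + 1}), Finset.sum_pair (by omega), if_pos hk, if_pos (by omega)]
  · have e₁ : ζ ((w - wseq (k - 1)) / (wseq k - wseq (k - 1))) = 1 :=
      hone _ ((one_le_div (hpos (by omega))).2 (by linarith))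
    have e₂ : ζ ((wseq (k + 1 + 1) - w) / (wseq (k + 1 + 1) - wseq (k + 1))) = 1 :=
      hone _ ((one_le_div (hpos (by omega))).2 (by linarith))
    have e₃ : (wseq (k + 1) - w) / (wseq (k + 1) - wseq k) =
        1 - (w - wseq k) / (wseq (k + 1) - wseq k) := by
      have := (hpos (Nat.lt_succ_self k)).ne'
      field_simp
      ring
    have e₄ := hsymm ((w - wseq k) / (wseq (k + 1) - wseq k))
    rw [e₁, e₂, e₃, Nat.add_sub_cancel, eq_sub_of_add_eq' e₄]
    ring
  · intro j hj
    simp only [Finset.mem_insert, Finset.mem_singleton, not_or] at hj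
    split_ifs with h2
    · rcases lt_or_gt_of_ne hj.1 with hlt | hgt
      · have : wseq (j + 1) ≤ wseq k := wseq_strictMono.monotone hlt
        rw [hzero ((wseq (j + 1) - w) / _) (div_nonpos_of_nonpos_of_nonneg (by linarith)
          (hpos (by omega)).le)]
        ring
      · have : wseq (k + 1) ≤ wseq (j - 1) := wseq_strictMono.monotone (by omega)
        rw [hzero ((w - wseq (j - 1)) / _) (div_nonpos_of_nonpos_of_nonneg (by linarith)
          (hpos (by omega)).le)]
        ring
    · rfl

/-- Consecutive terms of a good sequence are linearly independent. -/
theorem IsGoodSeq.eq_zero_of_combination {a : ℕ → Fin 3 → ℤ} (ha : IsGoodSeq a) {k : ℕ}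
    (hk : 1 ≤ k) {α β : ℝ} (h : ∀ i, α * (a k i : ℝ) + β * (a (k + 1) i : ℝ) = 0) :
    α = 0 ∧ β = 0 := by
  obtain ⟨hu, hdot⟩ := ha k hk
  obtain ⟨hv, -⟩ := ha (k + 1) (by omega)
  have hu' : ∑ i, (a k i : ℝ) ^ 2 = 4 * (k : ℝ) + 1 := by exact_mod_cast hu
  have hv' : ∑ i, (a (k + 1) i : ℝ) ^ 2 = 4 * ((k : ℝ) + 1) + 1 := by exact_mod_cast hv
  set U := ∑ i, (a k i : ℝ) ^ 2 with hU
  set V := ∑ i, (a (k + 1) i : ℝ) ^ 2 with hV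
  set D := ∑ i, (a k i : ℝ) * (a (k + 1) i : ℝ) with hD
  have hk0 : (0 : ℝ) ≤ k := Nat.cast_nonneg k
  have hUpos : 0 < U := by linarith
  have hVpos : 0 < V := by linarith
  have hsq : D ^ 2 ≤ U * V / 3 := by
    have := pow_le_pow_left₀ (abs_nonneg D) hdot 2
    rwa [sq_abs, div_pow, mul_pow, Real.sq_sqrt hUpos.le, Real.sq_sqrt hVpos.le,
      Real.sq_sqrt (by norm_num)] at this
  have hdet : U * V - D ^ 2 ≠ 0 := by
    have := mul_pos hUpos hVpos
    intro
    linarith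
  have h₁ : α * U + β * D = 0 := by
    simp only [hU, hD, Fin.sum_univ_three]
    linear_combination (a k 0 : ℝ) * h 0 + (a k 1 : ℝ) * h 1 + (a k 2 : ℝ) * h 2
  have h₂ : α * D + β * V = 0 := by
    simp only [hV, hD, Fin.sum_univ_three]
    linear_combination (a (k + 1) 0 : ℝ) * h 0 + (a (k + 1) 1 : ℝ) * h 1 +
      (a (k + 1) 2 : ℝ) * h 2
  constructor
  · exact (mul_eq_zero.1 (by linear_combination V * h₁ - D * h₂ :
      α * (U * V - D ^ 2) = 0)).resolve_right hdet
  · exact (mul_eq_zero.1 (by linear_combination U * h₂ - D * h₁ :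
      β * (U * V - D ^ 2) = 0)).resolve_right hdet

theorem two_mul_hSmall_lt_one : 2 * hSmall < 1 := by
  have h₁ : (2 : ℝ) ≤ 2 * Real.exp 1 := by linarith [Real.one_le_exp zero_le_one]
  have h₂ := pow_le_pow_left₀ (by norm_num) h₁ 10
  have h₃ : (2 : ℝ) < (2 * Real.exp 1) ^ 10 := lt_of_lt_of_le (by norm_num) h₂
  rw [hSmall, mul_one_div, div_lt_one (by linarith)]
  exact h₃

theorem hasDerivAt_cos_sum_update (c : Fin 3 → ℝ) (y : Fin 3 → ℝ) (i : Fin 3) :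
    HasDerivAt (fun t => Real.cos (∑ j, c j * Function.update y i t j))
      (-Real.sin (∑ j, c j * y j) * c i) (y i) := by
  have h : HasDerivAt (fun t => ∑ j, c j * Function.update y i t j) (c i) (y i) := by
    have := HasDerivAt.fun_sum (u := Finset.univ) fun j _ =>
      ((hasDerivAt_pi.1 (hasDerivAt_update y i (y i)) j).const_mul (c j))
    simpa [Pi.single_apply] using this
  simpa using h.cos

/-- At a point where the `y`-gradient of `f0` vanishes, both sine terms do. -/
theorem sin_terms_eq_zero {ζ : ℝ → ℝ} (hζ : IsCutoff ζ) {a : ℕ → Fin 3 → ℤ} (ha : IsGoodSeq a)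
    {k : ℕ} (hk : 2 ≤ k) {w : ℝ} (h₁ : wseq k ≤ w) (h₂ : w ≤ wseq (k + 1)) {y : Fin 3 → ℝ}
    (hy : ∀ i : Fin 3, deriv (fun t => f0 ζ a w (Function.update y i t)) (y i) = 0) :
    (1 - ζ ((w - wseq k) / (wseq (k + 1) - wseq k))) * Real.sin (∑ i, (a k i : ℝ) * y i) = 0 ∧
      ζ ((w - wseq k) / (wseq (k + 1) - wseq k)) *
        Real.sin (∑ i, (a (k + 1) i : ℝ) * y i) = 0 := by
  refine ha.eq_zero_of_combination (k := k) (by omega) fun i => ?_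
  have hi := hy i
  simp only [f0_eq_of_mem_Icc hζ a hk h₁ h₂] at hi
  rw [(((hasDerivAt_cos_sum_update (fun j => (a k j : ℝ)) y i).const_mul _).fun_add
    ((hasDerivAt_cos_sum_update (fun j => (a (k + 1) j : ℝ)) y i).const_mul _)).deriv] at hi
  linear_combination -hi

/-- At a point strictly between two nodes where the `w`-derivative of `f0` vanishes, the two
plane waves agree. -/
theorem cos_eq_cos_of_deriv_eq_zero {ζ : ℝ → ℝ} (hζ : IsCutoff ζ) {a : ℕ → Fin 3 → ℤ}
    {k : ℕ} (hk : 2 ≤ k) {w : ℝ} (h₁ : wseq k < w) (h₂ : w < wseq (k + 1)) {y : Fin 3 → ℝ}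
    (hd : deriv (fun t => f0 ζ a t y) w = 0) :
    Real.cos (∑ i, (a k i : ℝ) * y i) = Real.cos (∑ i, (a (k + 1) i : ℝ) * y i) := by
  have hL : 0 < wseq (k + 1) - wseq k := by linarith
  set A := Real.cos (∑ i, (a k i : ℝ) * y i)
  set B := Real.cos (∑ i, (a (k + 1) i : ℝ) * y i)
  have heq : (fun t => f0 ζ a t y) =ᶠ[nhds w] fun t =>
      (1 - ζ ((t - wseq k) / (wseq (k + 1) - wseq k))) * A +
        ζ ((t - wseq k) / (wseq (k + 1) - wseq k)) * B := by
    filter_upwards [Ioo_mem_nhds h₁ h₂] with t ht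
    exact f0_eq_of_mem_Icc hζ a hk ht.1.le ht.2.le y
  have hpos := hζ.2.2.2.2.1 ((w - wseq k) / (wseq (k + 1) - wseq k))
    ⟨div_pos (by linarith) hL, (div_lt_one hL).2 (by linarith)⟩
  have hdiff : DifferentiableAt ℝ ζ ((w - wseq k) / (wseq (k + 1) - wseq k)) :=
    (hζ.1.differentiable (by simp)) _
  have hcomp : HasDerivAt (fun t => ζ ((t - wseq k) / (wseq (k + 1) - wseq k))) _ w :=
    hdiff.hasDerivAt.comp w
      (((hasDerivAt_id w).sub_const (wseq k)).div_const (wseq (k + 1) - wseq k))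
  rw [heq.deriv_eq, (((hcomp.const_sub 1).mul_const A).fun_add (hcomp.mul_const B)).deriv] at hd
  have hprod := mul_pos hpos (one_div_pos.2 hL)
  have : (deriv ζ ((w - wseq k) / (wseq (k + 1) - wseq k)) *
      (1 / (wseq (k + 1) - wseq k))) * (B - A) = 0 := by linear_combination hd
  linarith [(mul_eq_zero.1 this).resolve_left hprod.ne']

/-- **Lemma 2.1.** If `w ≥ w₂` and `|f₀(w,y)| = 2h`, then the full gradient of `f₀`
at `(w,y)` (in all four variables) is nonzero. -/
theorem statement7 (ζ : ℝ → ℝ) (hζ : IsCutoff ζ) (a : ℕ → Fin 3 → ℤ) (ha : IsGoodSeq a)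
    (w : ℝ) (y : Fin 3 → ℝ) (hw : wseq 2 ≤ w)
    (habs : |f0 ζ a w y| = 2 * hSmall) :
    ¬ (deriv (fun t => f0 ζ a t y) w = 0 ∧
        ∀ i : Fin 3, deriv (fun t => f0 ζ a w (Function.update y i t)) (y i) = 0) := by
  rintro ⟨hd, hy⟩
  obtain ⟨k, hk, h₁, h₂⟩ := exists_wseq_le_lt hw
  obtain ⟨hs₁, hs₂⟩ := sin_terms_eq_zero hζ ha hk h₁ h₂.le hy
  have hf := f0_eq_of_mem_Icc hζ a hk h₁ h₂.le y
  suffices hunit : |f0 ζ a w y| = 1 by linarith [two_mul_hSmall_lt_one]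
  rcases h₁.eq_or_lt with rfl | hlt
  · have hζ0 : ζ 0 = 0 := hζ.2.1 0 le_rfl
    simp only [sub_self, zero_div, hζ0, sub_zero, one_mul, zero_mul, add_zero] at hf hs₁
    rw [hf]
    exact Real.abs_cos_eq_one_iff.2 (Real.sin_eq_zero_iff.1 hs₁)
  · have hcos := cos_eq_cos_of_deriv_eq_zero hζ hk hlt h₂ hd
    rcases mul_eq_zero.1 hs₁ with hs | hsin
    · rw [← sub_eq_zero.1 hs, one_mul] at hs₂
      rw [hf, hcos, ← add_mul, sub_add_cancel, one_mul]
      exact Real.abs_cos_eq_one_iff.2 (Real.sin_eq_zero_iff.1 hs₂)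
    · rw [hf, ← hcos, ← add_mul, sub_add_cancel, one_mul]
      exact Real.abs_cos_eq_one_iff.2 (Real.sin_eq_zero_iff.1 hsin)

end
end

section
/- Let 0 ≤ η ≤ 1, σ ∈ ℝ, α ∈ ℝ, μ ≥ π/2 and A > 0. Then the one-dimensional Lebesgue measure of the set {τ ∈ [−A,A] : σ−η ≤ cos(α+μτ) ≤ σ} is at most 4(A+2)√η/π. -/
open Real MeasureTheory

lemma sq_le_two_mul_sin_sq {d : ℝ} (hd0 : 0 ≤ d) (hd2 : d ≤ π / 2)
    (h : 2 * Real.sin d ^ 2 ≤ 1) : d ^ 2 ≤ 2 * Real.sin d ^ 2 := by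
  have hd4 : d ≤ π / 4 := by
    by_contra! hlt
    have h1 : Real.sin (π / 4) < Real.sin d :=
      Real.sin_lt_sin_of_lt_of_le_pi_div_two (by linarith [Real.pi_pos]) hd2 hlt
    rw [Real.sin_pi_div_four] at h1
    have h2 : √2 ^ 2 = (2 : ℝ) := Real.sq_sqrt (by norm_num)
    nlinarith [Real.sqrt_nonneg 2]
  rcases hd0.eq_or_lt with rfl | hpos
  · simp
  have hd : d < 0.8 := by linarith [Real.pi_lt_d2]
  have hs := Real.sin_gt_sub_cube hpos
  have hs' : 0.8 * d ≤ Real.sin d := by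
    have : d ^ 2 ≤ 0.64 := by nlinarith
    nlinarith
  nlinarith

lemma sub_le_two_mul_sqrt_of_cos_sub_cos_le {x y η : ℝ} (hx : 0 ≤ x) (hxy : x ≤ y) (hy : y ≤ π)
    (hη1 : η ≤ 1) (h : Real.cos x - Real.cos y ≤ η) : y - x ≤ 2 * √η := by
  have hcos : Real.cos x - Real.cos y
      = 2 * Real.sin ((x + y) / 2) * Real.sin ((y - x) / 2) := by
    rw [Real.cos_sub_cos, show (x - y) / 2 = -((y - x) / 2) by ring, Real.sin_neg]
    ring
  have hs0 : 0 ≤ Real.sin ((y - x) / 2) :=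
    Real.sin_nonneg_of_nonneg_of_le_pi (by linarith) (by linarith)
  have hsin : Real.sin ((y - x) / 2) ≤ Real.sin ((x + y) / 2) := by
    rcases le_total ((x + y) / 2) (π / 2) with hm | hm
    · exact Real.sin_le_sin_of_le_of_le_pi_div_two (by linarith) hm (by linarith)
    · rw [← Real.sin_pi_sub ((x + y) / 2)]
      exact Real.sin_le_sin_of_le_of_le_pi_div_two (by linarith) (by linarith) (by linarith)
  have hsq : 2 * Real.sin ((y - x) / 2) ^ 2 ≤ η := by nlinarith
  have hd := sq_le_two_mul_sin_sq (d := (y - x) / 2) (by linarith) (by linarith)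
    (hsq.trans hη1)
  linarith [Real.le_sqrt_of_sq_le (hd.trans hsq)]

lemma abs_sub_le_two_mul_sqrt_of_abs_cos_sub_cos_le {x y η : ℝ} (k : ℤ)
    (hx : x ∈ Set.Icc (k * π) ((k + 1) * π)) (hy : y ∈ Set.Icc (k * π) ((k + 1) * π))
    (hη1 : η ≤ 1) (h : |Real.cos x - Real.cos y| ≤ η) : |x - y| ≤ 2 * √η := by
  wlog hxy : x ≤ y generalizing x y
  · rw [abs_sub_comm]
    exact this hy hx (by rwa [abs_sub_comm]) (le_of_not_ge hxy)
  have hshift : |Real.cos (x - k * π) - Real.cos (y - k * π)| ≤ η := by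
    rwa [Real.cos_sub_int_mul_pi, Real.cos_sub_int_mul_pi, ← mul_sub, abs_mul,
      abs_zpow, abs_neg, abs_one, one_zpow, one_mul]
  have := sub_le_two_mul_sqrt_of_cos_sub_cos_le (x := x - k * π) (y := y - k * π)
    (by linarith [hx.1]) (by linarith) (by linarith [hy.2]) hη1 ((le_abs_self _).trans hshift)
  rw [abs_sub_comm, abs_of_nonneg (by linarith)]
  linarith

lemma volume_cos_mem_Icc_half_period_le (η σ α μ : ℝ) (hη1 : η ≤ 1) (hμ : 0 < μ) (k : ℤ) :
    volume {τ : ℝ | α + μ * τ ∈ Set.Icc (k * π) ((k + 1) * π) ∧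
      Real.cos (α + μ * τ) ∈ Set.Icc (σ - η) σ} ≤ ENNReal.ofReal (2 * √η / μ) := by
  refine (Real.volume_le_diam _).trans (Metric.ediam_le fun s hs t ht => ?_)
  rw [edist_dist, Real.dist_eq]
  apply ENNReal.ofReal_le_ofReal
  have h := abs_sub_le_two_mul_sqrt_of_abs_cos_sub_cos_le k hs.1 ht.1 hη1
    (abs_le.2 ⟨by linarith [hs.2.1, ht.2.2], by linarith [hs.2.2, ht.2.1]⟩)
  rw [show α + μ * s - (α + μ * t) = μ * (s - t) by ring, abs_mul, abs_of_pos hμ] at h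
  rwa [le_div_iff₀ hμ, mul_comm]

/-- **Corollary 2.4 d).** For `0 ≤ η ≤ 1`, `σ, α ∈ ℝ`, `μ ≥ π/2` and `A > 0`, the Lebesgue
measure of `{τ ∈ [-A,A] : σ - η ≤ cos(α + μτ) ≤ σ}` is at most `4(A+2)√η/π`. -/
theorem statement9 (η σ α μ A : ℝ) (hη0 : 0 ≤ η) (hη1 : η ≤ 1)
    (hμ : π / 2 ≤ μ) (hA : 0 < A) :
    volume {τ : ℝ | τ ∈ Set.Icc (-A) A ∧ Real.cos (α + μ * τ) ∈ Set.Icc (σ - η) σ} ≤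
      ENNReal.ofReal (4 * (A + 2) * Real.sqrt η / π) := by
  have hπ := Real.pi_pos
  have hμ0 : 0 < μ := by linarith
  set a : ℤ := ⌊(α - μ * A) / π⌋
  set b : ℤ := ⌊(α + μ * A) / π⌋
  have hab : a ≤ b := by
    apply Int.floor_le_floor
    gcongr
    nlinarith
  have hcover : {τ : ℝ | τ ∈ Set.Icc (-A) A ∧ Real.cos (α + μ * τ) ∈ Set.Icc (σ - η) σ} ⊆
      ⋃ k ∈ Finset.Icc a b, {τ : ℝ | α + μ * τ ∈ Set.Icc (k * π) ((k + 1) * π) ∧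
        Real.cos (α + μ * τ) ∈ Set.Icc (σ - η) σ} := by
    rintro τ ⟨⟨h1, h2⟩, hcos⟩
    simp only [Set.mem_iUnion]
    refine ⟨⌊(α + μ * τ) / π⌋, Finset.mem_Icc.2 ⟨?_, ?_⟩, ⟨?_, ?_⟩, hcos⟩
    · apply Int.floor_le_floor
      gcongr
      nlinarith
    · apply Int.floor_le_floor
      gcongr
    · exact (le_div_iff₀ hπ).1 (Int.floor_le _)
    · exact (div_le_iff₀ hπ).1 (Int.lt_floor_add_one _).le
  have hcard : ((Finset.Icc a b).card : ℝ) ≤ 2 * μ * A / π + 2 := by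
    have hcast : ((Finset.Icc a b).card : ℝ) = b + 1 - a := by
      rw [Int.card_Icc]
      exact_mod_cast Int.toNat_of_nonneg (by lia)
    have h1 := Int.floor_le ((α + μ * A) / π)
    have h2 := Int.lt_floor_add_one ((α - μ * A) / π)
    have h3 : (α + μ * A) / π - (α - μ * A) / π = 2 * μ * A / π := by ring
    rw [hcast]
    linarith
  have hinv : 1 / μ ≤ 2 / π := by
    rw [div_le_div_iff₀ hμ0 hπ]
    linarith
  calc _ ≤ ∑ k ∈ Finset.Icc a b, volume {τ : ℝ | α + μ * τ ∈ Set.Icc (k * π) ((k + 1) * π) ∧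
        Real.cos (α + μ * τ) ∈ Set.Icc (σ - η) σ} :=
        (measure_mono hcover).trans (measure_biUnion_finset_le _ _)
    _ ≤ ∑ _k ∈ Finset.Icc a b, ENNReal.ofReal (2 * √η / μ) :=
        Finset.sum_le_sum fun k _ => volume_cos_mem_Icc_half_period_le η σ α μ hη1 hμ0 k
    _ = ENNReal.ofReal ((Finset.Icc a b).card * (2 * √η / μ)) := by
        rw [Finset.sum_const, nsmul_eq_mul, ENNReal.ofReal_mul (Nat.cast_nonneg _),
          ENNReal.ofReal_natCast]
    _ ≤ _ := by
        apply ENNReal.ofReal_le_ofReal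
        calc _ ≤ (2 * μ * A / π + 2) * (2 * √η / μ) := by gcongr
          _ = 4 * A * √η / π + 4 * √η * (1 / μ) := by field_simp; ring
          _ ≤ 4 * A * √η / π + 4 * √η * (2 / π) := by gcongr
          _ = _ := by ring
end
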